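/- There exists ᾱ > 0 such that for every step size α ∈ (0, ᾱ) there is a least-squares solution x* of Ax = b with the following property: the sequences x̂(k) ∈ ℝ^{pn}, ω̂(k) ∈ ℝ^{qm}, ẑ(k) ∈ ℝ^{pn} defined by x̂(0) = 0, ω̂(0) = 0, ẑ(0) = 0 and x̂(k+1) = x̂(k) − α(Âᵀ(Âx̂(k) − b̂ − L̂_c^{1/2}ω̂(k)) + k_P L̂ x̂(k) + k_I ẑ(k)), ω̂(k+1) = ω̂(k) + α L̂_c^{1/2}(Âx̂(k) − b̂ − L̂_c^{1/2}ω̂(k)), ẑ(k+1) = ẑ(k) + α L̂ x̂(k), satisfy ‖x̂(k) − x̂*‖ ≤ C ρ^k for all k ∈ ℕ, for some C > 0 and ρ ∈ (0,1). -/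

import Mathlib

open Matrix

section Setup

variable {p q : ℕ} {mdim : Fin p → ℕ} {ndim : Fin q → ℕ}

/-- Index set for the stacked vector `x̂ ∈ ℝ^{pn}`. -/
abbrev ColIx (p q : ℕ) (ndim : Fin q → ℕ) : Type := Σ j : Fin q, Fin p × Fin (ndim j)

/-- Index set for the stacked vector `b̂ ∈ ℝ^{qm}`. -/
abbrev RowIx (p q : ℕ) (mdim : Fin p → ℕ) : Type := Fin q × Σ i : Fin p, Fin (mdim i)

/-- The block-diagonal matrix `Â = blockdiag(Â₁, …, Â_q)`, `Â_j = blockdiag(A_{1j}, …, A_{pj})`. -/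
def Ahat (A : Matrix (Σ i : Fin p, Fin (mdim i)) (Σ j : Fin q, Fin (ndim j)) ℝ) :
    Matrix (RowIx p q mdim) (ColIx p q ndim) ℝ :=
  fun r c => if r.1 = c.1 ∧ r.2.1 = c.2.1 then A r.2 ⟨c.1, c.2.2⟩ else 0

/-- The block-diagonal matrix `L̂ = blockdiag(L ⊗ I_{n₁}, …, L ⊗ I_{n_q})`. -/
def Lhat (L : Matrix (Fin p) (Fin p) ℝ) :
    Matrix (ColIx p q ndim) (ColIx p q ndim) ℝ :=
  fun r c =>
    if (⟨r.1, r.2.2⟩ : Σ j : Fin q, Fin (ndim j)) = ⟨c.1, c.2.2⟩ then L r.2.1 c.2.1 else 0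

/-- The Kronecker product `L̂_c = L_c ⊗ I_m`. -/
def Lchat (Lc : Matrix (Fin q) (Fin q) ℝ) :
    Matrix (RowIx p q mdim) (RowIx p q mdim) ℝ :=
  fun r c => if r.2 = c.2 then Lc r.1 c.1 else 0

/-- The stacked observation vector `b̂ ∈ ℝ^{qm}`. -/
def bhat (bblk : (i : Fin p) → Fin q → Fin (mdim i) → ℝ) : RowIx p q mdim → ℝ :=
  fun r => bblk r.2.1 r.1 r.2.2

/-- The observation vector `b ∈ ℝ^m`, with `b_i = Σ_j b_{ij}`. -/
def bvec (bblk : (i : Fin p) → Fin q → Fin (mdim i) → ℝ) : (Σ i : Fin p, Fin (mdim i)) → ℝ :=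
  fun a => ∑ j : Fin q, bblk a.1 j a.2

/-- `x` is a least-squares solution of `A x = b` (minimizer of the Euclidean residual). -/
def IsLSSol {ι κ : Type*} [Fintype ι] [Fintype κ] (A : Matrix ι κ ℝ) (b : ι → ℝ)
    (x : κ → ℝ) : Prop :=
  ∀ y : κ → ℝ, (A.mulVec x - b) ⬝ᵥ (A.mulVec x - b) ≤ (A.mulVec y - b) ⬝ᵥ (A.mulVec y - b)

/-- The consensus vector `x̂* ∈ ℝ^{pn}` obtained by stacking `p` copies of each portion of
`x* ∈ ℝⁿ`. -/
def stackVec (xstar : (Σ j : Fin q, Fin (ndim j)) → ℝ) : ColIx p q ndim → ℝ :=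
  fun c => xstar ⟨c.1, c.2.2⟩

end Setup


theorem abs_conv {E : Type*} [NormedAddCommGroup E] [NormedSpace ℝ E] [FiniteDimensional ℝ E]
    (N : E →ₗ[ℝ] E) (B : E →ₗ[ℝ] E →ₗ[ℝ] ℝ) (hsymm : ∀ x y, B x y = B y x)
    (c1 : ℝ) (hc1 : 0 < c1) (hpos : ∀ x, c1 * ‖x‖ ^ 2 ≤ B x x)
    (c : ℝ) (hc : 0 < c) (hN : ∀ e, c * B (N e) (N e) ≤ B e (N e))
    (g : E) (hg : ∀ e, N e = 0 → B e g = 0) :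
    ∃ αbar > (0:ℝ), ∃ w, N w = g ∧ ∀ α : ℝ, 0 < α → α < αbar →
      ∃ C > (0:ℝ), ∃ ρ : ℝ, 0 < ρ ∧ ρ < 1 ∧ ∀ u : ℕ → E, u 0 = 0 →
        (∀ k, u (k + 1) = u k - α • (N (u k) - g)) → ∀ k, ‖u k - w‖ ≤ C * ρ ^ k := by
  have hnn : ∀ x, 0 ≤ B x x := fun x => le_trans (by positivity) (hpos x)
  have hz : ∀ x, B x x = 0 → x = 0 := by
    intro x hx
    have h := hpos x
    rw [hx] at h
    have : ‖x‖ ^ 2 ≤ 0 := by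
      by_contra hh
      push Not at hh
      nlinarith [mul_pos hc1 hh]
    have h3 : ‖x‖ = 0 := by
      have := le_antisymm this (sq_nonneg _)
      exact pow_eq_zero_iff (two_ne_zero) |>.1 this
    exact norm_eq_zero.1 h3
  -- orthogonality
  have horth : ∀ e f, N e = 0 → B e (N f) = 0 := by
    intro e f he
    by_contra hne
    have key : ∀ t : ℝ, c * B (N f) (N f) ≤ B f (N f) + t * B e (N f) := by
      intro t
      have := hN (f + t • e)
      simpa [he] using this
    have := key ((c * B (N f) (N f) - B f (N f) - 1) / B e (N f))
    rw [div_mul_cancel₀ _ hne] at this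
    linarith
  have hdisj : Disjoint (LinearMap.ker N) (LinearMap.range N) := by
    rw [Submodule.disjoint_def]
    rintro x hx ⟨f, rfl⟩
    exact hz _ (horth _ f hx)
  have hcompl : IsCompl (LinearMap.ker N) (LinearMap.range N) := by
    refine Submodule.isCompl_iff_disjoint _ _ ?_ |>.2 hdisj
    have := LinearMap.finrank_range_add_finrank_ker N
    omega
  have hdec : ∀ x : E, ∃ e f, N e = 0 ∧ x = e + N f := by
    intro x
    have hx : x ∈ LinearMap.ker N ⊔ LinearMap.range N := by
      rw [hcompl.sup_eq_top]; trivial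
    obtain ⟨e, he, y, ⟨f, rfl⟩, rfl⟩ := Submodule.mem_sup.1 hx
    exact ⟨e, f, he, rfl⟩
  obtain ⟨w, hw, w', hw'⟩ : ∃ w, N w = g ∧ ∃ w', N w' = w := by
    obtain ⟨e, f, he, hgf⟩ := hdec g
    have h1 := hg e he
    rw [hgf, map_add, horth e f he, add_zero] at h1
    have h2 := hz e h1
    obtain ⟨e', f', he', hf'⟩ := hdec f
    refine ⟨N f', ?_, f', rfl⟩
    rw [hgf, h2, hf', map_add, he']; simp
  -- coercivity on the range
  obtain ⟨μ, hμ, hμN⟩ : ∃ μ > (0:ℝ), ∀ f, μ * B (N f) (N f) ≤ B (N (N f)) (N (N f)) := by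
    have hker : LinearMap.ker (N ∘ₗ (LinearMap.range N).subtype) = ⊥ := by
      rw [LinearMap.ker_eq_bot']
      rintro ⟨x, f, rfl⟩ hx
      ext
      exact hz _ (horth _ f hx)
    obtain ⟨K, hK, hKl⟩ := LinearMap.exists_antilipschitzWith _ hker
    have hb : ∀ f, ‖N f‖ ≤ K * ‖N (N f)‖ := by
      intro f
      have := hKl.le_mul_norm (map_zero _) (⟨N f, f, rfl⟩ : LinearMap.range N) 
      simpa using this
    obtain ⟨C2, hC2, hB⟩ : ∃ C2 > (0:ℝ), ∀ x, B x x ≤ C2 * ‖x‖ ^ 2 := by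
      let B' : E →ₗ[ℝ] E →L[ℝ] ℝ := (LinearMap.toContinuousLinearMap : (E →ₗ[ℝ] ℝ) ≃ₗ[ℝ] _).toLinearMap ∘ₗ B
      let B'' : E →L[ℝ] E →L[ℝ] ℝ := LinearMap.toContinuousLinearMap B'
      refine ⟨‖B''‖ + 1, by positivity, fun x => ?_⟩
      have h1 : B x x = B'' x x := rfl
      have h2 := B''.le_opNorm₂ x x
      have h3 := le_abs_self (B'' x x)
      rw [← Real.norm_eq_abs] at h3
      rw [h1]
      nlinarith [sq_nonneg ‖x‖]
    have hK' : (0:ℝ) < K := hK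
    refine ⟨c1 / (C2 * K ^ 2), by positivity, fun f => ?_⟩
    rw [div_mul_eq_mul_div, div_le_iff₀ (by positivity)]
    have h1 := hB (N f)
    have h2 := hpos (N (N f))
    have h3 : ‖N f‖ ^ 2 ≤ (K * ‖N (N f)‖) ^ 2 := by
      gcongr; exact hb f
    calc c1 * B (N f) (N f) ≤ c1 * (C2 * (K * ‖N (N f)‖) ^ 2) := by
          gcongr; exact h1.trans (by gcongr)
      _ = (c1 * ‖N (N f)‖ ^ 2) * (C2 * K ^ 2) := by ring
      _ ≤ _ := by gcongr
  refine ⟨c, hc, w, hw, fun α hα hαc => ?_⟩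
  set σ := max (1 - α * c * μ) (1/2) with hσ
  have hσ0 : 0 < σ := lt_of_lt_of_le (by norm_num) (le_max_right _ _)
  have hσ1 : σ < 1 := max_lt (by have : 0 < α * c * μ := by positivity
                                 linarith) (by norm_num)
  refine ⟨√(B w w / c1) + 1, by positivity, √σ, Real.sqrt_pos.2 hσ0, ?_, ?_⟩
  · rw [Real.sqrt_lt' one_pos]; simpa using hσ1
  intro u h0 hu
  have hmem : ∀ k, ∃ f, u k - w = N f := by
    intro k
    induction k with
    | zero => exact ⟨-w', by simp [h0, hw']⟩
    | succ k ih =>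
      obtain ⟨f, hf⟩ := ih
      refine ⟨f - α • (u k - w), ?_⟩
      rw [hu, map_sub, map_smul, ← hf, map_sub, hw]
      abel
  have hstep : ∀ k, B (u k - w) (u k - w) ≤ σ ^ k * B w w := by
    intro k
    induction k with
    | zero => simp [h0]
    | succ k ih =>
      obtain ⟨f, hf⟩ := hmem k
      have he : u (k+1) - w = (u k - w) - α • N (u k - w) := by
        rw [hu, map_sub, hw]; abel
      set e := u k - w with hedef
      have h1 : B (u (k+1) - w) (u (k+1) - w) = B e e - 2 * α * B e (N e) + α ^ 2 * B (N e) (N e) := by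
        rw [he]
        simp only [map_sub, map_smul, LinearMap.sub_apply, LinearMap.smul_apply, smul_eq_mul]
        rw [hsymm (N e) e]; ring
      have h2 := hN e
      have h3 : μ * B e e ≤ B (N e) (N e) := by rw [hf]; exact hμN f
      have h4 : B (u (k+1) - w) (u (k+1) - w) ≤ (1 - α * c * μ) * B e e := by
        rw [h1]
        have a1 : α * (c * B (N e) (N e)) ≤ α * B e (N e) := by gcongr
        have a2 : α * α * B (N e) (N e) ≤ α * c * B (N e) (N e) := by
          have := hnn (N e); gcongr
        have a3 : α * c * (μ * B e e) ≤ α * c * B (N e) (N e) := by gcongr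
        nlinarith
      calc _ ≤ (1 - α * c * μ) * B e e := h4
        _ ≤ σ * B e e := by have := hnn e; gcongr; exact le_max_left _ _
        _ ≤ σ * (σ ^ k * B w w) := by gcongr
        _ = _ := by ring
  intro k
  have h1 := (hpos _).trans (hstep k)
  have h2 : ‖u k - w‖ ^ 2 ≤ (√(B w w / c1) * √σ ^ k) ^ 2 := by
    rw [mul_pow, Real.sq_sqrt (div_nonneg (hnn w) hc1.le), ← pow_mul, mul_comm k 2, pow_mul,
      Real.sq_sqrt hσ0.le, div_mul_eq_mul_div, le_div_iff₀ hc1]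
    linarith
  have h3 := abs_le_of_sq_le_sq h2 (by positivity)
  have h4 : 0 ≤ √σ ^ k := by positivity
  have := le_abs_self ‖u k - w‖
  nlinarith

theorem mat_bound {m n : Type*} [Fintype m] [Fintype n] (M : Matrix m n ℝ) :
    ∃ K : ℝ, 0 < K ∧ ∀ x, (M *ᵥ x) ⬝ᵥ (M *ᵥ x) ≤ K * (x ⬝ᵥ x) := by
  refine ⟨∑ i, ∑ j, M i j ^ 2 + 1, by positivity, fun x => ?_⟩
  have hx : 0 ≤ x ⬝ᵥ x := Finset.sum_nonneg fun i _ => mul_self_nonneg _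
  have : (M *ᵥ x) ⬝ᵥ (M *ᵥ x) ≤ (∑ i, ∑ j, M i j ^ 2) * (x ⬝ᵥ x) := by
    rw [Finset.sum_mul]
    refine Finset.sum_le_sum fun i _ => ?_
    have := Finset.sum_mul_sq_le_sq_mul_sq Finset.univ (M i) x
    simp only [mulVec, dotProduct]
    simpa only [pow_two] using this
  linarith

theorem adj_dot {m n : Type*} [Fintype m] [Fintype n] (M : Matrix m n ℝ) (x : n → ℝ) (y : m → ℝ) :
    x ⬝ᵥ (Mᵀ *ᵥ y) = (M *ᵥ x) ⬝ᵥ y := by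
  rw [dotProduct_mulVec, vecMul_transpose]

theorem dot_young {n : Type*} [Fintype n] (x y : n → ℝ) (t : ℝ) :
    2 * t * (x ⬝ᵥ y) ≤ t ^ 2 * (x ⬝ᵥ x) + y ⬝ᵥ y := by
  have : 0 ≤ (t • x - y) ⬝ᵥ (t • x - y) := Finset.sum_nonneg fun i _ => mul_self_nonneg _
  simp only [sub_dotProduct, dotProduct_sub, smul_dotProduct, dotProduct_smul, smul_eq_mul] at this
  rw [dotProduct_comm y x] at this
  nlinarith

theorem dot_nn {n : Type*} [Fintype n] (x : n → ℝ) : 0 ≤ x ⬝ᵥ x :=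
  Finset.sum_nonneg fun i _ => mul_self_nonneg _

theorem norm_sq_le_dot {n : Type*} [Fintype n] (x : n → ℝ) : ‖x‖ ^ 2 ≤ x ⬝ᵥ x := by
  have : ‖x‖ ≤ √(x ⬝ᵥ x) := by
    rw [pi_norm_le_iff_of_nonneg (Real.sqrt_nonneg _)]
    intro i
    rw [Real.norm_eq_abs]
    apply Real.abs_le_sqrt
    rw [pow_two]
    exact Finset.single_le_sum (f := fun i => x i * x i) (fun i _ => mul_self_nonneg _)
      (Finset.mem_univ i)
  calc ‖x‖ ^ 2 ≤ √(x ⬝ᵥ x) ^ 2 := by gcongr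
    _ = _ := Real.sq_sqrt (dot_nn x)

/-- The system operator. -/
def sysN {m n l u : Type*} [Fintype m] [Fintype n] [Fintype l] [Fintype u]
    (A : Matrix m n ℝ) (S : Matrix m l ℝ) (D : Matrix u n ℝ) (kP κ : ℝ) :
    ((n → ℝ) × (l → ℝ) × (u → ℝ)) →ₗ[ℝ] ((n → ℝ) × (l → ℝ) × (u → ℝ)) where
  toFun e := (Aᵀ *ᵥ (A *ᵥ e.1 - S *ᵥ e.2.1) + kP • (Dᵀ *ᵥ (D *ᵥ e.1)) + κ • (Dᵀ *ᵥ e.2.2),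
    - (Sᵀ *ᵥ (A *ᵥ e.1 - S *ᵥ e.2.1)), - (κ • (D *ᵥ e.1)))
  map_add' e f := by
    ext i <;> simp [mulVec_add, mulVec_sub] <;> ring
  map_smul' t e := by
    ext i <;> simp [mulVec_smul, mulVec_sub] <;> ring

/-- The Lyapunov form. -/
def sysB {n l u : Type*} [Fintype n] [Fintype l] [Fintype u]
    (D : Matrix u n ℝ) (ε : ℝ) :
    ((n → ℝ) × (l → ℝ) × (u → ℝ)) →ₗ[ℝ] ((n → ℝ) × (l → ℝ) × (u → ℝ)) →ₗ[ℝ] ℝ :=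
  LinearMap.mk₂ ℝ (fun e f => e.1 ⬝ᵥ f.1 + e.2.1 ⬝ᵥ f.2.1 + e.2.2 ⬝ᵥ f.2.2
      + ε * ((D *ᵥ e.1) ⬝ᵥ f.2.2 + (D *ᵥ f.1) ⬝ᵥ e.2.2))
    (by intros; simp [mulVec_add]; ring)
    (by intros; simp [mulVec_smul]; ring)
    (by intros; simp [mulVec_add]; ring)
    (by intros; simp [mulVec_smul]; ring)

theorem sys_conv {m n l u : Type*} [Fintype m] [Fintype n] [Fintype l] [Fintype u]
    (A : Matrix m n ℝ) (S : Matrix m l ℝ) (D : Matrix u n ℝ) (kP κ : ℝ) (hkP : 0 < kP)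
    (hκ : 0 < κ) (b : m → ℝ) :
    ∃ αbar > (0:ℝ), ∃ (xs : n → ℝ) (ws : l → ℝ) (vs : u → ℝ),
      Aᵀ *ᵥ (A *ᵥ xs - b - S *ᵥ ws) + κ • (Dᵀ *ᵥ vs) = 0 ∧
      Sᵀ *ᵥ (A *ᵥ xs - b - S *ᵥ ws) = 0 ∧ D *ᵥ xs = 0 ∧
      ∀ α : ℝ, 0 < α → α < αbar → ∃ C > (0:ℝ), ∃ ρ : ℝ, 0 < ρ ∧ ρ < 1 ∧
        ∀ (x : ℕ → n → ℝ) (w : ℕ → l → ℝ) (v : ℕ → u → ℝ), x 0 = 0 → w 0 = 0 → v 0 = 0 →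
        (∀ k, x (k+1) = x k - α • (Aᵀ *ᵥ (A *ᵥ x k - b - S *ᵥ w k)
            + kP • (Dᵀ *ᵥ (D *ᵥ x k)) + κ • (Dᵀ *ᵥ v k))) →
        (∀ k, w (k+1) = w k + α • (Sᵀ *ᵥ (A *ᵥ x k - b - S *ᵥ w k))) →
        (∀ k, v (k+1) = v k + α • (κ • (D *ᵥ x k))) →
        ∀ k, ‖x k - xs‖ ≤ C * ρ ^ k := by
  obtain ⟨a, ha, hA⟩ := mat_bound Aᵀ
  obtain ⟨s, hs, hS⟩ := mat_bound Sᵀ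
  obtain ⟨d, hd, hD⟩ := mat_bound Dᵀ
  obtain ⟨d', hd', hD'⟩ := mat_bound D
  obtain ⟨ε, hε, he1, he2, he3, he4, he5⟩ : ∃ ε > (0:ℝ), ε ≤ 1/2 ∧ ε * d' ≤ 1/2 ∧
      ε * κ ≤ kP / 4 ∧ ε * (a / κ) ≤ 1 / 2 ∧ ε * (kP ^ 2 * d / κ) ≤ kP / 4 := by
    have key : ∀ X Y : ℝ, 0 < X → 0 < Y → ∀ᶠ ε in nhdsWithin (0:ℝ) (Set.Ioi 0), ε * X ≤ Y := by
      intro X Y hX hY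
      filter_upwards [Ioo_mem_nhdsGT (div_pos hY hX)] with ε hε
      have := hε.2
      rw [lt_div_iff₀ hX] at this
      exact this.le
    obtain ⟨ε, h⟩ := ((eventually_mem_nhdsWithin).and ((key 1 (1/2) (by norm_num) (by norm_num)).and
      ((key d' (1/2) hd' (by norm_num)).and ((key κ (kP/4) hκ (by positivity)).and
      ((key (a/κ) (1/2) (by positivity) (by norm_num)).and
      (key (kP^2*d/κ) (kP/4) (by positivity) (by positivity))))))).exists
    exact ⟨ε, h.1, by simpa using h.2.1, h.2.2⟩
  set N := sysN A S D kP κ with hNdef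
  set B := sysB (l := l) D ε with hBdef
  have hBapp : ∀ e f, B e f = e.1 ⬝ᵥ f.1 + e.2.1 ⬝ᵥ f.2.1 + e.2.2 ⬝ᵥ f.2.2
      + ε * ((D *ᵥ e.1) ⬝ᵥ f.2.2 + (D *ᵥ f.1) ⬝ᵥ e.2.2) := fun e f => rfl
  have hNapp : ∀ e, N e = (Aᵀ *ᵥ (A *ᵥ e.1 - S *ᵥ e.2.1) + kP • (Dᵀ *ᵥ (D *ᵥ e.1))
     + κ • (Dᵀ *ᵥ e.2.2), - (Sᵀ *ᵥ (A *ᵥ e.1 - S *ᵥ e.2.1)), - (κ • (D *ᵥ e.1))) := fun e => rfl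
  have hcross : ∀ (x : n → ℝ) (v : u → ℝ), |2 * ε * ((D *ᵥ x) ⬝ᵥ v)| ≤ (x ⬝ᵥ x + v ⬝ᵥ v) / 2 := by
    intro x v
    have h1 := dot_young (D *ᵥ x) v 1
    have h2 := dot_young (D *ᵥ x) v (-1)
    have h3 := hD' x
    have h4 : ε * ((D *ᵥ x) ⬝ᵥ (D *ᵥ x)) ≤ 1/2 * (x ⬝ᵥ x) := by
      calc _ ≤ ε * (d' * (x ⬝ᵥ x)) := by gcongr
        _ = (ε * d') * (x ⬝ᵥ x) := by ring
        _ ≤ _ := by have := dot_nn x; gcongr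
    have h5 : ε * (v ⬝ᵥ v) ≤ 1/2 * (v ⬝ᵥ v) := by have := dot_nn v; gcongr
    rw [abs_le]
    constructor <;> nlinarith
  have hBlow : ∀ e, (e.1 ⬝ᵥ e.1 + e.2.1 ⬝ᵥ e.2.1 + e.2.2 ⬝ᵥ e.2.2) / 2 ≤ B e e := by
    intro e
    rw [hBapp]
    have h1 := (abs_le.1 (hcross e.1 e.2.2)).1
    have h2 := dot_nn e.2.1
    nlinarith
  have hBup : ∀ e, B e e ≤ 2 * (e.1 ⬝ᵥ e.1 + e.2.1 ⬝ᵥ e.2.1 + e.2.2 ⬝ᵥ e.2.2) := by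
    intro e
    rw [hBapp]
    have h1 := (abs_le.1 (hcross e.1 e.2.2)).2
    have h2 := dot_nn e.2.1
    have h3 := dot_nn e.2.2
    have h4 := dot_nn e.1
    nlinarith
  -- lower bound on the dissipation
  have hdiss : ∀ e, 1/2 * ((A *ᵥ e.1 - S *ᵥ e.2.1) ⬝ᵥ (A *ᵥ e.1 - S *ᵥ e.2.1))
      + kP / 2 * ((D *ᵥ e.1) ⬝ᵥ (D *ᵥ e.1)) + ε * κ / 2 * ((Dᵀ *ᵥ e.2.2) ⬝ᵥ (Dᵀ *ᵥ e.2.2))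
      ≤ B e (N e) := by
    rintro ⟨x, w, v⟩
    rw [hBapp, hNapp]
    simp only
    set r := A *ᵥ x - S *ᵥ w with hr
    have e1 : x ⬝ᵥ (Aᵀ *ᵥ r) - w ⬝ᵥ (Sᵀ *ᵥ r) = r ⬝ᵥ r := by
      rw [adj_dot, adj_dot, ← sub_dotProduct]
    have e2 : x ⬝ᵥ (Dᵀ *ᵥ (D *ᵥ x)) = (D *ᵥ x) ⬝ᵥ (D *ᵥ x) := adj_dot _ _ _
    have e3 : x ⬝ᵥ (Dᵀ *ᵥ v) = (D *ᵥ x) ⬝ᵥ v := adj_dot _ _ _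
    have e4 : ∀ y, (D *ᵥ y) ⬝ᵥ v = y ⬝ᵥ (Dᵀ *ᵥ v) := fun y => (adj_dot _ _ _).symm
    set y := Dᵀ *ᵥ v with hy
    set dx := D *ᵥ x with hdx
    rw [e4]
    simp only [dotProduct_add, add_dotProduct, dotProduct_neg, dotProduct_smul, smul_dotProduct,
      smul_eq_mul]
    rw [e2, e3, dotProduct_comm v dx]
    have y1 := dot_young y (Aᵀ *ᵥ r) (-(κ/2))
    have y2 := dot_young y (kP • Dᵀ *ᵥ dx) (-(κ/2))
    simp only [dotProduct_smul, smul_dotProduct, smul_eq_mul] at y2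
    rw [dotProduct_comm] at y1 y2
    have b1 := hA r
    have b2 := hD dx
    have z1 : -(ε * ((Aᵀ *ᵥ r) ⬝ᵥ y)) ≤ ε * κ / 4 * (y ⬝ᵥ y) + 1/2 * (r ⬝ᵥ r) := by
      have : -((Aᵀ *ᵥ r) ⬝ᵥ y) ≤ κ / 4 * (y ⬝ᵥ y) + a / κ * (r ⬝ᵥ r) := by
        rw [← sub_nonneg]
        have : 0 ≤ (κ / 4 * (y ⬝ᵥ y) + a / κ * (r ⬝ᵥ r) - -((Aᵀ *ᵥ r) ⬝ᵥ y)) * κ := by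
          field_simp
          nlinarith
        exact nonneg_of_mul_nonneg_left this hκ
      have h2 := mul_le_mul_of_nonneg_left this hε.le
      have h3 := mul_le_mul_of_nonneg_right he4 (dot_nn r)
      linarith
    have z2 : -(ε * (kP * ((Dᵀ *ᵥ dx) ⬝ᵥ y))) ≤ ε * κ / 4 * (y ⬝ᵥ y) + kP/4 * (dx ⬝ᵥ dx) := by
      have : -(kP * ((Dᵀ *ᵥ dx) ⬝ᵥ y)) ≤ κ / 4 * (y ⬝ᵥ y) + kP ^ 2 * d / κ * (dx ⬝ᵥ dx) := by
        rw [← sub_nonneg]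
        have b3 := mul_le_mul_of_nonneg_left b2 (sq_nonneg kP)
        have : 0 ≤ (κ / 4 * (y ⬝ᵥ y) + kP ^ 2 * d / κ * (dx ⬝ᵥ dx)
            - -(kP * ((Dᵀ *ᵥ dx) ⬝ᵥ y))) * κ := by
          field_simp
          nlinarith
        exact nonneg_of_mul_nonneg_left this hκ
      have h2 := mul_le_mul_of_nonneg_left this hε.le
      have h3 := mul_le_mul_of_nonneg_right he5 (dot_nn dx)
      linarith
    have z3 := mul_le_mul_of_nonneg_right he3 (dot_nn dx)
    linarith
  -- upper bound on N e
  have hNup : ∀ e, B (N e) (N e) ≤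
      (6 * a + 2 * s) * ((A *ᵥ e.1 - S *ᵥ e.2.1) ⬝ᵥ (A *ᵥ e.1 - S *ᵥ e.2.1))
      + (6 * kP ^ 2 * d + 2 * κ ^ 2) * ((D *ᵥ e.1) ⬝ᵥ (D *ᵥ e.1))
      + 6 * κ ^ 2 * ((Dᵀ *ᵥ e.2.2) ⬝ᵥ (Dᵀ *ᵥ e.2.2)) := by
    rintro ⟨x, w, v⟩
    refine (hBup _).trans ?_
    rw [hNapp]
    simp only
    set r := A *ᵥ x - S *ᵥ w with hr
    set y := Dᵀ *ᵥ v with hy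
    set dx := D *ᵥ x with hdx
    have b1 := hA r
    have b2 := mul_le_mul_of_nonneg_left (hD dx) (sq_nonneg kP)
    have b3 := hS r
    have t1 := dot_young (Aᵀ *ᵥ r) (kP • Dᵀ *ᵥ dx) 1
    have t2 := dot_young (Aᵀ *ᵥ r) (κ • y) 1
    have t3 := dot_young (kP • Dᵀ *ᵥ dx) (κ • y) 1
    simp only [dotProduct_add, add_dotProduct, dotProduct_neg, neg_dotProduct, dotProduct_smul,
      smul_dotProduct, smul_eq_mul] at t1 t2 t3 ⊢
    rw [dotProduct_comm (Dᵀ *ᵥ dx) (Aᵀ *ᵥ r), dotProduct_comm y (Aᵀ *ᵥ r),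
      dotProduct_comm y (Dᵀ *ᵥ dx)]
    nlinarith
  obtain ⟨c, hc, hc1, hc2, hc3⟩ : ∃ c > (0:ℝ), c * (6 * a + 2 * s) ≤ 1/2 ∧
      c * (6 * kP ^ 2 * d + 2 * κ ^ 2) ≤ kP / 2 ∧ c * (6 * κ ^ 2) ≤ ε * κ / 2 := by
    have key : ∀ X Y : ℝ, 0 < X → 0 < Y → ∀ᶠ ε in nhdsWithin (0:ℝ) (Set.Ioi 0), ε * X ≤ Y := by
      intro X Y hX hY
      filter_upwards [Ioo_mem_nhdsGT (div_pos hY hX)] with ε hε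
      have := hε.2
      rw [lt_div_iff₀ hX] at this
      exact this.le
    obtain ⟨c, h⟩ := ((eventually_mem_nhdsWithin).and
      ((key (6 * a + 2 * s) (1/2) (by positivity) (by norm_num)).and
      ((key (6 * kP ^ 2 * d + 2 * κ ^ 2) (kP/2) (by positivity) (by positivity)).and
      (key (6 * κ ^ 2) (ε * κ/2) (by positivity) (by positivity))))).exists
    exact ⟨c, h⟩
  have hmain : ∀ e, c * B (N e) (N e) ≤ B e (N e) := by
    intro e
    refine le_trans ?_ (hdiss e)
    have h1 := mul_le_mul_of_nonneg_left (hNup e) hc.le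
    have h2 := mul_le_mul_of_nonneg_right hc1 (dot_nn (A *ᵥ e.1 - S *ᵥ e.2.1))
    have h3 := mul_le_mul_of_nonneg_right hc2 (dot_nn (D *ᵥ e.1))
    have h4 := mul_le_mul_of_nonneg_right hc3 (dot_nn (Dᵀ *ᵥ e.2.2))
    linarith
  have hlow : ∀ e, 1/2 * ‖e‖ ^ 2 ≤ B e e := by
    intro e
    refine le_trans ?_ (hBlow e)
    have n1 := norm_sq_le_dot e.1
    have n2 := norm_sq_le_dot e.2.1
    have n3 := norm_sq_le_dot e.2.2
    have p1 := dot_nn e.1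
    have p2 := dot_nn e.2.1
    have p3 := dot_nn e.2.2
    rw [Prod.norm_def, Prod.norm_def]
    rcases max_choice ‖e.1‖ (max ‖e.2.1‖ ‖e.2.2‖) with h | h
    · rw [h]; linarith
    · rw [h]
      rcases max_choice ‖e.2.1‖ ‖e.2.2‖ with h | h <;> rw [h] <;> linarith
  obtain ⟨αbar, hα, ⟨xs, ws, vs⟩, hfix, hconv⟩ := abs_conv N B
    (by intro e f; rw [hBapp, hBapp, dotProduct_comm e.1, dotProduct_comm e.2.1,
          dotProduct_comm e.2.2]; ring)
    (1/2) (by norm_num) hlow c hc hmain (Aᵀ *ᵥ b, -(Sᵀ *ᵥ b), 0) (by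
      rintro ⟨x, w, v⟩ he
      have h := hdiss (x, w, v)
      rw [he, map_zero] at h
      simp only at h
      have p1 := dot_nn (A *ᵥ x - S *ᵥ w)
      have p2 := mul_nonneg hkP.le (dot_nn (D *ᵥ x))
      have p3 := mul_nonneg (mul_pos hε hκ).le (dot_nn (Dᵀ *ᵥ v))
      have q1 : A *ᵥ x - S *ᵥ w = 0 := by
        rw [← dotProduct_self_eq_zero]; linarith
      have q3 : Dᵀ *ᵥ v = 0 := by
        have : ε * κ * ((Dᵀ *ᵥ v) ⬝ᵥ (Dᵀ *ᵥ v)) = 0 := by linarith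
        rw [← dotProduct_self_eq_zero]
        exact (mul_eq_zero.1 this).resolve_left (mul_pos hε hκ).ne'
      rw [hBapp]
      simp only [dotProduct_neg, dotProduct_zero, adj_dot]
      rw [← adj_dot D, q3, dotProduct_zero, ← sub_eq_add_neg, ← sub_dotProduct, q1]
      simp)
  rw [hNapp, Prod.mk.injEq, Prod.mk.injEq] at hfix
  obtain ⟨f1, f2, f3⟩ := hfix
  simp only at f1 f2 f3
  have g3 : D *ᵥ xs = 0 := by
    rw [neg_eq_zero] at f3
    exact (smul_eq_zero.1 f3).resolve_left hκ.ne'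
  refine ⟨αbar, hα, xs, ws, vs, ?_, ?_, g3, ?_⟩
  · rw [g3] at f1
    have : A *ᵥ xs - b - S *ᵥ ws = (A *ᵥ xs - S *ᵥ ws) - b := by abel
    rw [this, mulVec_sub _ _ b, ← f1]
    simp
  · have : A *ᵥ xs - b - S *ᵥ ws = (A *ᵥ xs - S *ᵥ ws) - b := by abel
    rw [this, mulVec_sub _ _ b, neg_inj.1 f2, sub_self]
  intro α h0 h1
  obtain ⟨C, hC, ρ, hρ0, hρ1, hk⟩ := hconv α h0 h1
  refine ⟨C, hC, ρ, hρ0, hρ1, ?_⟩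
  intro x w v x0 w0 v0 hx hw hv k
  refine le_trans ?_ (hk (fun k => (x k, w k, v k)) (by simp [x0, w0, v0]) ?_ k)
  · exact norm_fst_le ((x k, w k, v k) - (xs, ws, vs))
  · intro k
    have : A *ᵥ x k - b - S *ᵥ w k = (A *ᵥ x k - S *ᵥ w k) - b := by abel
    rw [hNapp]
    ext i
    · simp [hx, this, mulVec_sub _ _ b]; ring
    · simp [hw, this, mulVec_sub _ _ b]; ring
    · simp [hv]

theorem Lhat_mulVec_apply {p q : ℕ} {ndim : Fin q → ℕ} (M : Matrix (Fin p) (Fin p) ℝ)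
    (x : ColIx p q ndim → ℝ) (j : Fin q) (i : Fin p) (t : Fin (ndim j)) :
    (Lhat M *ᵥ x) ⟨j, i, t⟩ = ∑ i', M i i' * x ⟨j, i', t⟩ := by
  simp only [mulVec, dotProduct, Lhat]
  rw [Fintype.sum_sigma, Finset.sum_eq_single j]
  · rw [Fintype.sum_prod_type]
    refine Finset.sum_congr rfl fun i' _ => ?_
    rw [Finset.sum_eq_single t]
    · simp
    · intro t' _ ht
      simp [Ne.symm ht]
    · simp
  · intro j' _ hj
    refine Finset.sum_eq_zero fun y _ => ?_
    rw [if_neg, zero_mul]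
    intro h
    exact hj (congrArg Sigma.fst h).symm
  · simp

theorem Lhat_transpose {p q : ℕ} {ndim : Fin q → ℕ} (M : Matrix (Fin p) (Fin p) ℝ) :
    (Lhat M : Matrix (ColIx p q ndim) (ColIx p q ndim) ℝ)ᵀ = Lhat Mᵀ := by
  ext r c
  simp only [Lhat, transpose_apply]
  congr 1
  exact propext eq_comm

theorem Lhat_mul_mulVec {p q : ℕ} {ndim : Fin q → ℕ} (M M' : Matrix (Fin p) (Fin p) ℝ)
    (x : ColIx p q ndim → ℝ) :
    Lhat M *ᵥ (Lhat M' *ᵥ x) = Lhat (M * M') *ᵥ x := by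
  ext ⟨j, i, t⟩
  simp only [Lhat_mulVec_apply]
  simp only [Matrix.mul_apply, Finset.mul_sum, Finset.sum_mul, mul_assoc]
  exact Finset.sum_comm

theorem Lchat_mulVec_apply {p q : ℕ} {mdim : Fin p → ℕ} (M : Matrix (Fin q) (Fin q) ℝ)
    (x : RowIx p q mdim → ℝ) (j : Fin q) (a : Σ i : Fin p, Fin (mdim i)) :
    (Lchat M *ᵥ x) (j, a) = ∑ j', M j j' * x (j', a) := by
  simp only [mulVec, dotProduct, Lchat]
  rw [Fintype.sum_prod_type]
  refine Finset.sum_congr rfl fun i' _ => ?_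
  simp

theorem Ahat_stack_apply {p q : ℕ} {mdim : Fin p → ℕ} {ndim : Fin q → ℕ}
    (A : Matrix (Σ i : Fin p, Fin (mdim i)) (Σ j : Fin q, Fin (ndim j)) ℝ)
    (y : (Σ j : Fin q, Fin (ndim j)) → ℝ) (j : Fin q) (a : Σ i : Fin p, Fin (mdim i)) :
    (Ahat A *ᵥ (stackVec y : ColIx p q ndim → ℝ)) (j, a) = ∑ t, A a ⟨j, t⟩ * y ⟨j, t⟩ := by
  simp only [mulVec, dotProduct, Ahat, stackVec]
  rw [Fintype.sum_sigma, Finset.sum_eq_single j]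
  · rw [Fintype.sum_prod_type, Finset.sum_eq_single a.1]
    · simp
    · intro i' _ hi
      simp [Ne.symm hi]
    · simp
  · intro j' _ hj
    simp [Ne.symm hj]
  · simp

theorem Ahat_stack_sum {p q : ℕ} {mdim : Fin p → ℕ} {ndim : Fin q → ℕ}
    (A : Matrix (Σ i : Fin p, Fin (mdim i)) (Σ j : Fin q, Fin (ndim j)) ℝ)
    (y : (Σ j : Fin q, Fin (ndim j)) → ℝ) (a : Σ i : Fin p, Fin (mdim i)) :
    ∑ j, (Ahat A *ᵥ (stackVec y : ColIx p q ndim → ℝ)) (j, a) = (A *ᵥ y) a := by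
  simp only [Ahat_stack_apply]
  simp only [mulVec, dotProduct]
  rw [Fintype.sum_sigma]

theorem lap_factor {p : ℕ} (G : SimpleGraph (Fin p)) [DecidableRel G.Adj] :
    ∃ d : Matrix (Fin p) (Fin p) ℝ, G.lapMatrix ℝ = dᵀ * d := by
  open scoped MatrixOrder in
  obtain ⟨d, hd⟩ := CStarAlgebra.nonneg_iff_eq_star_mul_self.mp
    (SimpleGraph.posSemidef_lapMatrix ℝ G).nonneg
  exact ⟨d, by rw [hd, star_eq_conjTranspose, conjTranspose_eq_transpose_of_trivial]⟩

theorem lap_zero_const {p : ℕ} (G : SimpleGraph (Fin p)) [DecidableRel G.Adj] (hG : G.Connected)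
    (f : Fin p → ℝ) (h : ∀ i, ∑ i', G.lapMatrix ℝ i i' * f i' = 0) (i i' : Fin p) :
    f i = f i' := by
  refine (G.lapMatrix_mulVec_eq_zero_iff_forall_reachable.1 ?_) i i' (hG.preconnected i i')
  ext i
  exact h i

theorem lap_const {p : ℕ} (G : SimpleGraph (Fin p)) [DecidableRel G.Adj] (t : ℝ) (i : Fin p) :
    ∑ i', G.lapMatrix ℝ i i' * t = 0 := by
  rw [← Finset.sum_mul]
  have := congrFun (G.lapMatrix_mulVec_const_eq_zero (R := ℝ)) i
  simp only [mulVec, dotProduct, mul_one, Pi.zero_apply] at this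
  rw [this, zero_mul]

theorem zero_of_gram {m n : Type*} [Fintype m] [Fintype n] (M : Matrix m n ℝ) (x : n → ℝ)
    (h : Mᵀ *ᵥ (M *ᵥ x) = 0) : M *ᵥ x = 0 := by
  rw [← dotProduct_self_eq_zero, ← adj_dot, h, dotProduct_zero]

theorem ls_of_orth {ι κ : Type*} [Fintype ι] [Fintype κ] (A : Matrix ι κ ℝ) (b : ι → ℝ)
    (x : κ → ℝ) (h : ∀ y, (A *ᵥ y) ⬝ᵥ (A *ᵥ x - b) = 0) : IsLSSol A b x := by
  intro y
  have h1 := h (y - x)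
  have h2 : A *ᵥ y - b = A *ᵥ (y - x) + (A *ᵥ x - b) := by rw [mulVec_sub]; abel
  rw [h2, add_dotProduct, dotProduct_add, dotProduct_add, dotProduct_comm (A *ᵥ x - b) (A *ᵥ (y - x)),
    h1]
  have := dot_nn (A *ᵥ (y - x))
  linarith

/-- **Corollary 1 (discrete-time convergence, no scheduling).** For sufficiently small step
size `α > 0`, the discretized algorithm started at the origin converges exponentially to a
stacked least-squares solution `x̂*` of `A x = b`. -/
theorem dtdls_exponential_convergence
    (p q : ℕ) (hp : 0 < p) (hq : 0 < q)
    (mdim : Fin p → ℕ) (ndim : Fin q → ℕ)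
    (hmdim : ∀ i, 0 < mdim i) (hndim : ∀ j, 0 < ndim j)
    (A : Matrix (Σ i : Fin p, Fin (mdim i)) (Σ j : Fin q, Fin (ndim j)) ℝ)
    (bblk : (i : Fin p) → Fin q → Fin (mdim i) → ℝ)
    (G : SimpleGraph (Fin p)) [DecidableRel G.Adj] (hG : G.Connected)
    (Gc : SimpleGraph (Fin q)) [DecidableRel Gc.Adj] (hGc : Gc.Connected)
    -- the (unique) positive semidefinite square root of `L̂_c`
    (Lchalf : Matrix (RowIx p q mdim) (RowIx p q mdim) ℝ)
    (hLchalf : Lchalf.PosSemidef ∧ Lchalf * Lchalf = Lchat (Gc.lapMatrix ℝ))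
    -- tunable parameters
    (kP kI : ℝ) (hkP : 0 < kP) (hkI : 0 < kI) :
    ∃ αbar > (0:ℝ), ∀ α : ℝ, 0 < α → α < αbar →
      ∀ (xh : ℕ → ColIx p q ndim → ℝ) (ωh : ℕ → RowIx p q mdim → ℝ)
        (zh : ℕ → ColIx p q ndim → ℝ),
        xh 0 = 0 → ωh 0 = 0 → zh 0 = 0 →
        (∀ k : ℕ, xh (k + 1) = xh k -
          α • ((Ahat A)ᵀ.mulVec ((Ahat A).mulVec (xh k) - bhat bblk - Lchalf.mulVec (ωh k))
            + kP • (Lhat (G.lapMatrix ℝ)).mulVec (xh k) + kI • zh k)) →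
        (∀ k : ℕ, ωh (k + 1) = ωh k +
          α • Lchalf.mulVec ((Ahat A).mulVec (xh k) - bhat bblk - Lchalf.mulVec (ωh k))) →
        (∀ k : ℕ, zh (k + 1) = zh k + α • (Lhat (G.lapMatrix ℝ)).mulVec (xh k)) →
        ∃ xstar : (Σ j : Fin q, Fin (ndim j)) → ℝ,
          IsLSSol A (bvec bblk) xstar ∧
            ∃ C > (0:ℝ), ∃ ρ : ℝ, 0 < ρ ∧ ρ < 1 ∧
              ∀ k : ℕ, ‖xh k - stackVec xstar‖ ≤ C * ρ ^ k := by
  obtain ⟨d, hd⟩ := lap_factor G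
  obtain ⟨hPSD, hsq⟩ := hLchalf
  have hST : Lchalfᵀ = Lchalf := by
    rw [← conjTranspose_eq_transpose_of_trivial]; exact hPSD.1
  set D : Matrix (ColIx p q ndim) (ColIx p q ndim) ℝ := Lhat d with hDdef
  have hDD : ∀ x, Dᵀ *ᵥ (D *ᵥ x) = Lhat (G.lapMatrix ℝ) *ᵥ x := by
    intro x
    rw [hDdef, Lhat_transpose, Lhat_mul_mulVec, hd]
  set κ := √kI with hκdef
  have hκ : 0 < κ := Real.sqrt_pos.2 hkI
  have hκ2 : κ * κ = kI := Real.mul_self_sqrt hkI.le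
  obtain ⟨αbar, hαbar, xs, ws, vs, f1, f2, f3, hconv⟩ :=
    sys_conv (Ahat A) Lchalf D kP κ hkP hκ (bhat bblk)
  have hLx : Lhat (G.lapMatrix ℝ) *ᵥ xs = 0 := by rw [← hDD, f3, mulVec_zero]
  -- consensus
  let xstar : (Σ j : Fin q, Fin (ndim j)) → ℝ := fun c => xs ⟨c.1, ⟨0, hp⟩, c.2⟩
  have hstack : (stackVec xstar : ColIx p q ndim → ℝ) = xs := by
    ext ⟨j, i, t⟩
    refine lap_zero_const G hG (fun i => xs ⟨j, i, t⟩) (fun i => ?_) _ _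
    rw [← Lhat_mulVec_apply, hLx]; rfl
  -- residual
  set r := Ahat A *ᵥ xs - bhat bblk - Lchalf *ᵥ ws with hr
  have hLcr : Lchat (Gc.lapMatrix ℝ) *ᵥ r = 0 := by
    rw [← hsq, ← mulVec_mulVec]
    rw [hST] at f2
    rw [f2, mulVec_zero]
  have hrconst : ∀ a j j', r (j, a) = r (j', a) := by
    intro a j j'
    refine lap_zero_const Gc hGc (fun j => r (j, a)) (fun j => ?_) _ _
    rw [← Lchat_mulVec_apply, hLcr]; rfl
  have hSsum : ∀ a, ∑ j, (Lchalf *ᵥ ws) (j, a) = 0 := by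
    intro a
    let h : RowIx p q mdim → ℝ := fun r => if r.2 = a then 1 else 0
    have h1 : Lchat (Gc.lapMatrix ℝ) *ᵥ h = 0 := by
      ext ⟨j, a'⟩
      rw [Lchat_mulVec_apply]
      exact lap_const Gc (if a' = a then 1 else 0) j
    have h2 : Lchalf *ᵥ h = 0 := by
      apply zero_of_gram
      rw [hST, mulVec_mulVec, hsq, h1]
    have h3 : h ⬝ᵥ (Lchalf *ᵥ ws) = 0 := by
      have := adj_dot Lchalf h ws
      rw [hST, h2, zero_dotProduct] at this
      exact this
    rw [← h3]
    simp only [dotProduct, h]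
    rw [Fintype.sum_prod_type]
    refine Finset.sum_congr rfl fun j _ => ?_
    simp
  let j0 : Fin q := ⟨0, hq⟩
  have hrsum : ∀ a, (q : ℝ) * r (j0, a) = (A *ᵥ xstar - bvec bblk) a := by
    intro a
    have h1 : ∑ j, r (j, a) = (q : ℝ) * r (j0, a) := by
      rw [Finset.sum_congr rfl fun j _ => hrconst a j j0]
      simp
    rw [← h1, hr]
    simp only [Pi.sub_apply, Finset.sum_sub_distrib]
    rw [hSsum, sub_zero, ← hstack, Ahat_stack_sum]
    rfl
  have horth : ∀ y, (A *ᵥ y) ⬝ᵥ (A *ᵥ xstar - bvec bblk) = 0 := by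
    intro y
    have h1 : D *ᵥ (stackVec y : ColIx p q ndim → ℝ) = 0 := by
      apply zero_of_gram
      rw [hDD]
      ext ⟨j, i, t⟩
      rw [Lhat_mulVec_apply]
      exact lap_const G (y ⟨j, t⟩) i
    have h2 : (Ahat A *ᵥ (stackVec y : ColIx p q ndim → ℝ)) ⬝ᵥ r = 0 := by
      have := congrArg (fun z => (stackVec y : ColIx p q ndim → ℝ) ⬝ᵥ z) f1
      simp only [dotProduct_add, dotProduct_smul, adj_dot, h1, zero_dotProduct, smul_zero,
        add_zero, dotProduct_zero] at this
      exact this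
    have h3 : (A *ᵥ y) ⬝ᵥ (fun a => r (j0, a)) = 0 := by
      rw [← h2]
      simp only [dotProduct]
      rw [Fintype.sum_prod_type, Finset.sum_comm]
      refine Finset.sum_congr rfl fun a _ => ?_
      rw [← Ahat_stack_sum, Finset.sum_mul]
      refine Finset.sum_congr rfl fun j _ => ?_
      rw [hrconst a j0 j]
    have h4 : A *ᵥ xstar - bvec bblk = (q : ℝ) • (fun a => r (j0, a)) := by
      ext a
      rw [← hrsum]; rfl
    rw [h4, dotProduct_smul, h3, smul_zero]
  refine ⟨αbar, hαbar, fun α hα0 hα1 xh ωh zh hx0 hω0 hz0 hx hω hz => ?_⟩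
  refine ⟨xstar, ls_of_orth _ _ _ horth, ?_⟩
  obtain ⟨C, hC, ρ, hρ0, hρ1, hk⟩ := hconv α hα0 hα1
  refine ⟨C, hC, ρ, hρ0, hρ1, ?_⟩
  rw [hstack]
  -- lift the integral state
  let v : ℕ → ColIx p q ndim → ℝ := fun k =>
    Nat.rec 0 (fun k v => v + α • (κ • (D *ᵥ xh k))) k
  have hv : ∀ k, v (k + 1) = v k + α • (κ • (D *ᵥ xh k)) := fun k => rfl
  have hzv : ∀ k, κ • (Dᵀ *ᵥ v k) = kI • zh k := by
    intro k
    induction k with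
    | zero => 
      have : v 0 = 0 := rfl
      rw [this, hz0]; simp
    | succ k ih =>
      rw [hv, hz, mulVec_add, mulVec_smul, mulVec_smul, hDD, smul_add, ih, smul_add, ← hκ2]
      simp only [smul_smul]
      congr 2
      ring
  refine hk xh ωh v hx0 hω0 rfl ?_ ?_ hv
  · intro k
    rw [hzv, hDD]
    exact hx k
  · intro k
    rw [hST]
    exact hω k
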